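/- Let B be a block of a profinite group G with cyclic defect group D. Then D is a finite group if and only if B is finite-dimensional over k. -/

import Mathlib

open scoped Classical
set_option maxHeartbeats 1000000
set_option synthInstance.maxHeartbeats 400000

noncomputable section

namespace ProfiniteBlocks

variable (k : Type) [Field k] (G : Type) [Group G] [TopologicalSpace G]

/-- Discrete topology on each finite level group algebra. -/
instance (X : Type) : TopologicalSpace (MonoidAlgebra k X) := ⊥

/-- The canonical quotient homomorphism `G/N → G/M` for `N ≤ M`. -/
def qHom (N M : OpenNormalSubgroup G) (h : N ≤ M) :
    G ⧸ N.toSubgroup →* G ⧸ M.toSubgroup :=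
  QuotientGroup.map _ _ (MonoidHom.id G) (fun x hx => h hx)

/-- The induced algebra homomorphism `k[G/N] → k[G/M]` for `N ≤ M`. -/
def tHom (N M : OpenNormalSubgroup G) (h : N ≤ M) :
    MonoidAlgebra k (G ⧸ N.toSubgroup) →ₐ[k] MonoidAlgebra k (G ⧸ M.toSubgroup) :=
  MonoidAlgebra.mapDomainAlgHom k k (qHom G N M h)

/-- The completed group algebra `k⟦G⟧`, realized as the inverse limit of the finite
level group algebras `k[G/N]` over all open normal subgroups `N` of `G`, sitting inside
their product. -/
def CGA : Subalgebra k (∀ N : OpenNormalSubgroup G, MonoidAlgebra k (G ⧸ N.toSubgroup)) where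
  carrier := {x | ∀ (N M : OpenNormalSubgroup G) (h : N ≤ M), tHom k G N M h (x N) = x M}
  add_mem' hx hy N M h := by simp [map_add, hx N M h, hy N M h]
  mul_mem' hx hy N M h := by simp [map_mul, hx N M h, hy N M h]
  algebraMap_mem' r N M h := by
    simp [tHom, MonoidAlgebra.mapDomainAlgHom, MonoidAlgebra.mapDomainRingHom,
      Finsupp.mapDomain_single]

instance : Ring (CGA k G) := inferInstance
instance : Algebra k (CGA k G) := inferInstance

/-- `k⟦G⟧` carries the inverse limit topology (each `k[G/N]` being discrete). -/
instance : TopologicalSpace (CGA k G) := inferInstanceAs (TopologicalSpace (Subtype _))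

/-- The canonical (continuous) inclusion of `G` into `k⟦G⟧`. -/
def ofG : G →* CGA k G where
  toFun g := ⟨fun N => MonoidAlgebra.single ((g : G) : G ⧸ N.toSubgroup) 1, by
    intro N M h
    simp [tHom, MonoidAlgebra.mapDomainAlgHom, MonoidAlgebra.mapDomainRingHom,
      Finsupp.mapDomain_single, qHom, QuotientGroup.map_mk]
    rfl⟩
  map_one' := by
    ext N
    simp [MonoidAlgebra.one_def]
  map_mul' g g' := by
    ext N
    simp [MonoidAlgebra.single_mul_single]


/-- The map between quotient modules induced by `f` (the canonical map whenever
`f` carries `P` into `Q`). -/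
def mapQ' {R X Y : Type} [Ring R] [AddCommGroup X] [AddCommGroup Y] [Module R X]
    [Module R Y] (P : Submodule R X) (Q : Submodule R Y) (f : X →ₗ[R] Y) :
    (X ⧸ P) →ₗ[R] (Y ⧸ Q) :=
  if h : P ≤ Q.comap f then Submodule.mapQ P Q f h else 0

/-- The map between submodules induced by `f` (the canonical restriction whenever
`f` carries `P` into `Q`). -/
def restrict' {R X Y : Type} [Ring R] [AddCommGroup X] [AddCommGroup Y] [Module R X]
    [Module R Y] (P : Submodule R X) (Q : Submodule R Y) (f : X →ₗ[R] Y) :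
    P →ₗ[R] Q :=
  if h : ∀ x ∈ P, f x ∈ Q then f.restrict h else 0

/-- The subquotient `W / W'` of a module. -/
abbrev subQuot {R X : Type} [Ring R] [AddCommGroup X] [Module R X]
    (W W' : Submodule R X) : Type :=
  W ⧸ (W'.comap W.subtype)

/-- The radical of a topological module: the intersection of its maximal open
submodules. -/
def radical (R : Type) [Ring R] (X : Type) [AddCommGroup X] [Module R X]
    [TopologicalSpace X] : Submodule R X :=
  sInf {W : Submodule R X | IsCoatom W ∧ IsOpen (W : Set X)}

/-- Iterated radicals `Rad^i(X)`, with `Rad^0(X) = X`. -/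
def radPow (R : Type) [Ring R] (X : Type) [AddCommGroup X] [Module R X]
    [TopologicalSpace X] : ℕ → Submodule R X
  | 0 => ⊤
  | (n + 1) => (radical R (radPow R X n)).map (radPow R X n).subtype

/-- A topological module is semisimple if every closed submodule has a closed
complement. -/
def IsSemisimpleTop (R : Type) [Ring R] (X : Type) [AddCommGroup X] [Module R X]
    [TopologicalSpace X] : Prop :=
  ∀ W : Submodule R X, IsClosed (W : Set X) →
    ∃ W' : Submodule R X, IsClosed (W' : Set X) ∧ IsCompl W W'

/-- The socle of a topological module: the largest closed semisimple submodule
(defined as the join of all closed semisimple submodules). -/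
def socle (R : Type) [Ring R] (X : Type) [AddCommGroup X] [Module R X]
    [TopologicalSpace X] : Submodule R X :=
  sSup {W : Submodule R X | IsClosed (W : Set X) ∧ IsSemisimpleTop R W}

/-- A module is uniserial if its submodules form a chain. -/
def Uniserial (R : Type) [Ring R] (X : Type) [AddCommGroup X] [Module R X] : Prop :=
  ∀ W W' : Submodule R X, W ≤ W' ∨ W' ≤ W

/-- A topological module is (topologically) indecomposable if it is non-zero and
admits no non-trivial decomposition into closed direct summands. -/
def IsIndecTop (R : Type) [Ring R] (X : Type) [AddCommGroup X] [Module R X]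
    [TopologicalSpace X] : Prop :=
  Nontrivial X ∧ ∀ W W' : Submodule R X, IsClosed (W : Set X) → IsClosed (W' : Set X) →
    IsCompl W W' → W = ⊥ ∨ W' = ⊥

/-- The inverse limit of a compatible system of modules indexed by a preorder,
realized as the submodule of compatible families in the product. -/
def compatLim {ι : Type} [Preorder ι] {R : Type} [Ring R] (T : ι → Type)
    [∀ i, AddCommGroup (T i)] [∀ i, Module R (T i)]
    (t : ∀ i j, i ≤ j → (T i →ₗ[R] T j)) : Submodule R (∀ i, T i) where
  carrier := {f | ∀ (i j : ι) (h : i ≤ j), t i j h (f i) = f j}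
  add_mem' ha hb i j h := by simp only [Pi.add_apply, map_add]; rw [ha i j h, hb i j h]
  zero_mem' i j h := by simp
  smul_mem' c a ha i j h := by simp only [Pi.smul_apply, map_smul]; rw [ha i j h]

/-- `X` has exactly `n` composition factors (measured along the radical series). -/
def HasNFactors (R : Type) [Ring R] (X : Type) [AddCommGroup X] [Module R X]
    [TopologicalSpace X] (n : ℕ) : Prop :=
  radPow R X n = ⊥ ∧ ∀ m < n, radPow R X m ≠ ⊥

/-- `X` has infinitely many composition factors. -/
def HasInfFactors (R : Type) [Ring R] (X : Type) [AddCommGroup X] [Module R X]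
    [TopologicalSpace X] : Prop :=
  ∀ n : ℕ, radPow R X n ≠ ⊥



section Coinvariants

variable {k : Type} [Field k] {G : Type} [Group G] [TopologicalSpace G]

variable (k G) in
/-- The (closed) submodule `I_N U` of a topological `k⟦G⟧`-module `U`: the smallest
closed submodule containing all elements `n • u - u` for `n ∈ N`.  Its quotient is the
module of `N`-coinvariants. -/
def coinvKer (N : OpenNormalSubgroup G) (U : Type) [AddCommGroup U]
    [Module (CGA k G) U] [TopologicalSpace U] : Submodule (CGA k G) U :=
  sInf {W : Submodule (CGA k G) U | IsClosed (W : Set U) ∧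
    ∀ n ∈ N.toSubgroup, ∀ u : U, ofG k G n • u - u ∈ W}

variable (k G) in
/-- The module of `N`-coinvariants `U_N` of a topological `k⟦G⟧`-module `U`. -/
abbrev coinv (N : OpenNormalSubgroup G) (U : Type) [AddCommGroup U]
    [Module (CGA k G) U] [TopologicalSpace U] : Type :=
  U ⧸ coinvKer k G N U

variable (k G) in
/-- The canonical projection `φ_N : U → U_N`. -/
def phi (N : OpenNormalSubgroup G) (U : Type) [AddCommGroup U]
    [Module (CGA k G) U] [TopologicalSpace U] : U →ₗ[CGA k G] coinv k G N U :=
  (coinvKer k G N U).mkQ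

lemma coinvKer_mono {N M : OpenNormalSubgroup G} (h : N ≤ M) (U : Type) [AddCommGroup U]
    [Module (CGA k G) U] [TopologicalSpace U] : coinvKer k G N U ≤ coinvKer k G M U :=
  sInf_le_sInf (fun W hW => ⟨hW.1, fun n hn u => hW.2 n (h hn) u⟩)

variable (k G) in
/-- The canonical projection `φ_{MN} : U_N → U_M` for `N ≤ M`. -/
def phiT (N M : OpenNormalSubgroup G) (h : N ≤ M) (U : Type) [AddCommGroup U]
    [Module (CGA k G) U] [TopologicalSpace U] :
    coinv k G N U →ₗ[CGA k G] coinv k G M U :=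
  Submodule.mapQ _ _ LinearMap.id (fun _ hx => coinvKer_mono h U hx)

variable (k G) in
/-- `N` acts trivially on the `k⟦G⟧`-module `W`. -/
def NTrivial (N : OpenNormalSubgroup G) (W : Type) [AddCommGroup W]
    [Module (CGA k G) W] : Prop :=
  ∀ n ∈ N.toSubgroup, ∀ w : W, ofG k G n • w = w

end Coinvariants

section Pseudocompact

variable (k : Type) [Field k]

/-- A pseudocompact module over a topological `k`-algebra `A`: a Hausdorff topological
module possessing a basis of neighbourhoods of `0` consisting of open submodules of
finite codimension which intersect in `0`, and which is the inverse limit of the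
corresponding discrete quotients. -/
structure IsPseudocompactMod (A : Type) [Ring A] [Algebra k A] [TopologicalSpace A]
    (X : Type) [AddCommGroup X] [Module k X] [Module A X] [IsScalarTower k A X]
    [TopologicalSpace X] : Prop where
  t2 : T2Space X
  addGroup : IsTopologicalAddGroup X
  contSMul : ContinuousSMul A X
  basis : (nhds (0 : X)).HasBasis
    (fun V : Submodule A X => IsOpen (V : Set X) ∧
      FiniteDimensional k (X ⧸ V.restrictScalars k))
    (fun V => (V : Set X))
  inf_bot : (⨅ (V : Submodule A X) (_ : IsOpen (V : Set X) ∧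
      FiniteDimensional k (X ⧸ V.restrictScalars k)), V) = ⊥
  complete : ∀ c : ∀ V : {V : Submodule A X // IsOpen (V : Set X) ∧
      FiniteDimensional k (X ⧸ V.restrictScalars k)}, X ⧸ V.1,
    (∀ (V W : {V : Submodule A X // IsOpen (V : Set X) ∧
        FiniteDimensional k (X ⧸ V.restrictScalars k)}), V.1 ≤ W.1 →
      mapQ' V.1 W.1 LinearMap.id (c V) = c W) →
    ∃ x : X, ∀ V, c V = Submodule.Quotient.mk x

end Pseudocompact

section Blocks

variable (R : Type) [Ring R]

/-- A block idempotent: a centrally primitive idempotent of `R`. -/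
structure IsBlockIdem (e : R) : Prop where
  idem : IsIdempotentElem e
  ne_zero : e ≠ 0
  central : e ∈ Set.center R
  primitive : ∀ f g : R, f ∈ Set.center R → g ∈ Set.center R → IsIdempotentElem f →
    IsIdempotentElem g → f * g = 0 → g * f = 0 → e = f + g → f = 0 ∨ g = 0

/-- The block `B = Re` determined by a central idempotent `e`, as a left `R`-module. -/
def blockMod (e : R) (he : e ∈ Set.center R) : Submodule R R where
  carrier := {a : R | a * e = a}
  add_mem' := by intro a b ha hb; simp only [Set.mem_setOf_eq, add_mul] at *; rw [ha, hb]
  zero_mem' := by simp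
  smul_mem' := by
    intro c a ha
    simp only [Set.mem_setOf_eq, smul_eq_mul, mul_assoc] at *
    rw [ha]

/-- A module belongs to the block of the central idempotent `e` if `e` acts as the
identity on it. -/
def InBlock {X : Type} [AddCommGroup X] [Module R X] (e : R) : Prop :=
  ∀ x : X, e • x = x

end Blocks

section Defect

variable {k : Type} [Field k] {G : Type} [Group G] [TopologicalSpace G]

variable (k G) in
/-- The conjugation action of `G` on `k⟦G⟧`. -/
def conjAct (g : G) (x : CGA k G) : CGA k G :=
  ofG k G g * x * ofG k G g⁻¹

variable (k G) in
/-- The `H`-fixed points of `k⟦G⟧` under conjugation. -/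
def fixedBy (H : Subgroup G) : Set (CGA k G) :=
  {x : CGA k G | ∀ h ∈ H, conjAct k G h x = x}

variable (k G) in
/-- The relative trace map `Tr_H^G` on `k⟦G⟧` (a finite sum over coset
representatives when `H` is open). -/
def trMap (H : Subgroup G) (x : CGA k G) : CGA k G :=
  ∑ᶠ c : G ⧸ H, conjAct k G (Quotient.out c) x

variable (k G) in
/-- The image `Tr_H^G(k⟦G⟧^H)`. -/
def trImage (H : Subgroup G) : Set (CGA k G) :=
  trMap k G H '' fixedBy k G H

variable (k G) in
/-- `D` satisfies the defect property for `e`: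
`e ∈ ⋂_N Tr_{DN}^G (k⟦G⟧^{DN})`. -/
def DefectProp (e : CGA k G) (D : Subgroup G) : Prop :=
  ∀ N : OpenNormalSubgroup G, e ∈ trImage k G (D ⊔ N.toSubgroup)

variable (k G) in
/-- `D` is a defect group of the block of `e`: a closed subgroup, minimal subject to
the defect property. -/
structure IsDefectGroup (e : CGA k G) (D : Subgroup G) : Prop where
  closed : IsClosed (D : Set G)
  defect : DefectProp k G e D
  minimal : ∀ D' : Subgroup G, IsClosed ((D' : Set G)) → D' ≤ D →
    DefectProp k G e D' → D' = D

end Defect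

section FiniteDefect

variable (k : Type) [Field k] (Q : Type) [Group Q]

/-- Conjugation on a finite level group algebra `k[Q]`. -/
def conjActF (q : Q) (x : MonoidAlgebra k Q) : MonoidAlgebra k Q :=
  MonoidAlgebra.single q 1 * x * MonoidAlgebra.single q⁻¹ 1

/-- `H`-fixed points of `k[Q]` under conjugation. -/
def fixedByF (H : Subgroup Q) : Set (MonoidAlgebra k Q) :=
  {x | ∀ h ∈ H, conjActF k Q h x = x}

/-- The relative trace map `Tr_H^Q` on `k[Q]`. -/
def trMapF (H : Subgroup Q) (x : MonoidAlgebra k Q) : MonoidAlgebra k Q :=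
  ∑ᶠ c : Q ⧸ H, conjActF k Q (Quotient.out c) x

/-- The image `Tr_H^Q(k[Q]^H)`. -/
def trImageF (H : Subgroup Q) : Set (MonoidAlgebra k Q) :=
  trMapF k Q H '' fixedByF k Q H

/-- `Dq` is a defect group of the block of `e` in the group algebra `k[Q]`. -/
structure IsDefectGroupF (e : MonoidAlgebra k Q) (Dq : Subgroup Q) : Prop where
  defect : e ∈ trImageF k Q Dq
  minimal : ∀ D' : Subgroup Q, D' ≤ Dq → e ∈ trImageF k Q D' → D' = Dq

end FiniteDefect

section CyclicDefect

variable {k : Type} [Field k] {G : Type} [Group G] [TopologicalSpace G]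

variable (G) in
/-- A subgroup is procyclic if it possesses a dense cyclic (abstract) subgroup. -/
def IsProcyclic (D : Subgroup G) : Prop :=
  ∃ g : G, closure ((Subgroup.zpowers g : Subgroup G) : Set G) = (D : Set G)

variable (G) in
/-- `D` is isomorphic, as a topological group, to the `p`-adic integers `ℤ_p`. -/
def IsZpGroup (p : ℕ) [Fact p.Prime] (D : Subgroup G) : Prop :=
  ∃ φ : D ≃ₜ Multiplicative ℤ_[p], ∀ x y : D, φ (x * y) = φ x * φ y

variable (G) in
/-- `D` is a cyclic pro-`p` group: either a finite cyclic `p`-group or `ℤ_p`. -/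
def IsCyclicProP (p : ℕ) [Fact p.Prime] (D : Subgroup G) : Prop :=
  (Finite D ∧ IsPGroup p D ∧ IsCyclic D) ∨ IsZpGroup G p D

end CyclicDefect

section Simples

variable {k : Type} [Field k] {G : Type} [Group G] [TopologicalSpace G]

variable (k G) in
/-- The projection `k⟦G⟧ → k[G/N]`. -/
def projN (N : OpenNormalSubgroup G) (x : CGA k G) :
    MonoidAlgebra k (G ⧸ N.toSubgroup) :=
  (x : ∀ N : OpenNormalSubgroup G, MonoidAlgebra k (G ⧸ N.toSubgroup)) N

variable (k G) in
/-- `N` acts trivially on every simple module of the block of `e`. -/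
def TrivOnSimples (e : CGA k G) (N : OpenNormalSubgroup G) : Prop :=
  ∀ (S : Type) [AddCommGroup S] [Module (CGA k G) S],
    IsSimpleModule (CGA k G) S → InBlock (CGA k G) (X := S) e → NTrivial k G N S

variable (k G) in
/-- Membership of `N` in the standard cofinal system `𝒩` for the block `B` of `e`
with defect group `D`: the coinvariant algebra `B_N` is a block of `k[G/N]` with
defect group `DN/N`, and `N` acts trivially on every simple `B`-module. -/
structure GoodN (e : CGA k G) (D : Subgroup G) (N : OpenNormalSubgroup G) : Prop where
  blockN : IsBlockIdem (MonoidAlgebra k (G ⧸ N.toSubgroup)) (projN k G N e)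
  defectN : IsDefectGroupF k (G ⧸ N.toSubgroup) (projN k G N e)
    (D.map (QuotientGroup.mk' N.toSubgroup))
  triv : TrivOnSimples k G e N

/-- A cofinal set of open normal subgroups. -/
def IsCofinal {G : Type} [Group G] [TopologicalSpace G]
    (𝒩 : Set (OpenNormalSubgroup G)) : Prop :=
  ∀ M : OpenNormalSubgroup G, ∃ N ∈ 𝒩, N ≤ M

variable (k G) in
/-- A pseudocompact module is pro-uniserial (w.r.t. the cofinal system `𝒩`) if all
its coinvariant quotients at members of `𝒩` are uniserial. -/
def ProUniserial (𝒩 : Set (OpenNormalSubgroup G)) (U : Type) [AddCommGroup U]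
    [Module (CGA k G) U] [TopologicalSpace U] : Prop :=
  ∀ N ∈ 𝒩, Uniserial (CGA k G) (coinv k G N U)

variable (k G) in
/-- `S` is a composition factor of the pseudocompact module `U`: it is a composition
factor of some finite coinvariant quotient `U_N`. -/
def IsCompFactorOf (U : Type) [AddCommGroup U] [Module (CGA k G) U]
    [TopologicalSpace U] (S : Type) [AddCommGroup S] [Module (CGA k G) S] : Prop :=
  ∃ (N : OpenNormalSubgroup G) (W W' : Submodule (CGA k G) (coinv k G N U)),
    W' ≤ W ∧ Nonempty (subQuot W W' ≃ₗ[CGA k G] S)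

variable (k G) in
/-- `S` is a composition factor of the finite-dimensional module `X`. -/
def IsCompFactorFin (X : Type) [AddCommGroup X] [Module (CGA k G) X]
    (S : Type) [AddCommGroup S] [Module (CGA k G) S] : Prop :=
  ∃ W W' : Submodule (CGA k G) X, W' ≤ W ∧ Nonempty (subQuot W W' ≃ₗ[CGA k G] S)

end Simples

section Projective

variable {k : Type} [Field k] {G : Type} [Group G] [TopologicalSpace G]

variable (k G) in
/-- A pseudocompact `k⟦G⟧`-module is (categorically) projective if every continuous
surjection onto it from a pseudocompact module splits. -/
def IsPCProjective (P : Type) [AddCommGroup P] [Module (CGA k G) P]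
    [TopologicalSpace P] : Prop :=
  ∀ (W : Type) [AddCommGroup W] [Module k W] [Module (CGA k G) W]
    [IsScalarTower k (CGA k G) W] [TopologicalSpace W],
    IsPseudocompactMod k (CGA k G) W →
    ∀ f : W →ₗ[CGA k G] P, Continuous f → Function.Surjective f →
      ∃ s : P →ₗ[CGA k G] W, Continuous s ∧ f.comp s = LinearMap.id

variable (k G) in
/-- `P` is a projective cover of the simple module `S` in the block of `e`:
a pseudocompact projective module of the block together with a surjection onto `S`
whose kernel is superfluous (contained in the radical). -/
structure IsProjCover (e : CGA k G) (P : Type) [AddCommGroup P] [Module k P]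
    [Module (CGA k G) P] [IsScalarTower k (CGA k G) P] [TopologicalSpace P]
    (S : Type) [AddCommGroup S] [Module (CGA k G) S] : Prop where
  pseudocompact : IsPseudocompactMod k (CGA k G) P
  inBlock : InBlock (CGA k G) (X := P) e
  projective : IsPCProjective k G P
  cover : ∃ π : P →ₗ[CGA k G] S, Function.Surjective π ∧
    LinearMap.ker π ≤ radical (CGA k G) P

end Projective




/-- The map between subquotients induced by `f`. -/
def subQuotMap {R X Y : Type} [Ring R] [AddCommGroup X] [AddCommGroup Y] [Module R X]
    [Module R Y] (W W' : Submodule R X) (V V' : Submodule R Y) (f : X →ₗ[R] Y) :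
    subQuot W W' →ₗ[R] subQuot V V' :=
  mapQ' (W'.comap W.subtype) (V'.comap V.subtype) (restrict' W V f)

/-- The conditions of Proposition 3.8 on a pair of pro-uniserial submodules `X`, `Y`
of an indecomposable projective `P`: `X ∩ Y = Soc(P)`, `X + Y = Rad(P)`, and
`Rad(P)/Soc(P) ≅ X/Soc(P) ⊕ Y/Soc(P)` with no common composition factors. -/
def ProUniserialPair (k : Type) [Field k] (G : Type) [Group G] [TopologicalSpace G]
    (𝒩 : Set (OpenNormalSubgroup G)) (P : Type) [AddCommGroup P]
    [Module (CGA k G) P] [TopologicalSpace P]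
    (X Y : Submodule (CGA k G) P) : Prop :=
  ProUniserial k G 𝒩 X ∧ ProUniserial k G 𝒩 Y ∧
  X ⊓ Y = socle (CGA k G) P ∧
  X ⊔ Y = radical (CGA k G) P ∧
  Nonempty ((subQuot (radical (CGA k G) P) (socle (CGA k G) P)) ≃ₗ[CGA k G]
    (subQuot X (socle (CGA k G) P) × subQuot Y (socle (CGA k G) P))) ∧
  ∀ (T : Type) [AddCommGroup T] [Module (CGA k G) T], IsSimpleModule (CGA k G) T →
    ¬ (IsCompFactorOf k G (subQuot X (socle (CGA k G) P)) T ∧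
       IsCompFactorOf k G (subQuot Y (socle (CGA k G) P)) T)

/-- `S : ι → Type` is a complete set of pairwise non-isomorphic representatives of
the simple modules of the block of `e`. -/
def IsSimpleReps (k : Type) [Field k] (G : Type) [Group G] [TopologicalSpace G]
    (e : CGA k G) {ι : Type} (S : ι → Type) [∀ i, AddCommGroup (S i)]
    [∀ i, Module (CGA k G) (S i)] : Prop :=
  (∀ i, IsSimpleModule (CGA k G) (S i) ∧ InBlock (CGA k G) (X := S i) e) ∧
  (∀ i j, i ≠ j → IsEmpty (S i ≃ₗ[CGA k G] S j)) ∧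
  (∀ (T : Type) [AddCommGroup T] [Module (CGA k G) T],
    IsSimpleModule (CGA k G) T → InBlock (CGA k G) (X := T) e →
      ∃ i, Nonempty (T ≃ₗ[CGA k G] S i))

section Brauer

/-- The size of the `ρ`-orbit of `i` (the number of edges at the corresponding vertex
of the Brauer tree). -/
def orbSize {ι : Type} (ρ : Equiv.Perm ι) (i : ι) : ℕ :=
  Function.minimalPeriod ρ i

/-- Data describing the exceptional vertex of a Brauer tree: `none` if there is no
exceptional vertex, and otherwise a flag recording whether it is a `ρ`-vertex or a
`σ`-vertex together with an edge adjacent to it. -/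
abbrev ExcVertex (ι : Type) : Type := Option (Bool × ι)

/-- The edge `i` is adjacent to the exceptional vertex, its `ρ`-endpoint being
exceptional. -/
def AdjExcRho {ι : Type} (ρ : Equiv.Perm ι) (exc : ExcVertex ι) (i : ι) : Prop :=
  ∃ j : ι, exc = some (true, j) ∧ ρ.SameCycle j i

/-- The edge `i` is adjacent to the exceptional vertex, its `σ`-endpoint being
exceptional. -/
def AdjExcSigma {ι : Type} (σ : Equiv.Perm ι) (exc : ExcVertex ι) (i : ι) : Prop :=
  ∃ j : ι, exc = some (false, j) ∧ σ.SameCycle j i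

/-- The edge `i` is adjacent to the exceptional vertex. -/
def AdjExc {ι : Type} (ρ σ : Equiv.Perm ι) (exc : ExcVertex ι) (i : ι) : Prop :=
  AdjExcRho ρ exc i ∨ AdjExcSigma σ exc i

end Brauer


section GroupAlgebra

variable {k : Type} [Field k] {Q Q' : Type} [Group Q] [Group Q']

variable (k) in
/-- The average of a finite subgroup `H` in `k[Q]`. -/
def avg (H : Subgroup Q) : MonoidAlgebra k Q :=
  (Nat.card H : k)⁻¹ • ∑ᶠ h : H, MonoidAlgebra.single (h : Q) 1

lemma avg_eq_sum (H : Subgroup Q) [Fintype H] :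
    avg k H = (Nat.card H : k)⁻¹ • ∑ h : H, MonoidAlgebra.single (h : Q) 1 := by
  rw [avg, finsum_eq_sum_of_fintype]

lemma single_mul_avg (H : Subgroup Q) [Finite H] {q : Q} (hq : q ∈ H) :
    MonoidAlgebra.single q 1 * avg k H = avg k H := by
  have := Fintype.ofFinite H
  rw [avg_eq_sum, mul_smul_comm, Finset.mul_sum]
  congr 1
  refine Fintype.sum_equiv (Equiv.mulLeft (⟨q, hq⟩ : H)) _ _ fun h => ?_
  simp [MonoidAlgebra.single_mul_single]

lemma avg_mul_single (H : Subgroup Q) [Finite H] {q : Q} (hq : q ∈ H) :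
    avg k H * MonoidAlgebra.single q 1 = avg k H := by
  have := Fintype.ofFinite H
  rw [avg_eq_sum, smul_mul_assoc, Finset.sum_mul]
  congr 1
  refine Fintype.sum_equiv (Equiv.mulRight (⟨q, hq⟩ : H)) _ _ fun h => ?_
  simp [MonoidAlgebra.single_mul_single]

lemma avg_mul_of_left_invariant (H : Subgroup Q) [Finite H] (hH : (Nat.card H : k) ≠ 0)
    {x : MonoidAlgebra k Q} (hx : ∀ h ∈ H, MonoidAlgebra.single h 1 * x = x) :
    avg k H * x = x := by
  have := Fintype.ofFinite H
  rw [avg_eq_sum, smul_mul_assoc, Finset.sum_mul, Finset.sum_congr rfl fun (h : H) _ => hx h h.2,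
    Finset.sum_const, Finset.card_univ, ← Nat.card_eq_fintype_card, ← Nat.cast_smul_eq_nsmul k,
    smul_smul, inv_mul_cancel₀ hH, one_smul]

lemma mul_avg_of_right_invariant (H : Subgroup Q) [Finite H] (hH : (Nat.card H : k) ≠ 0)
    {x : MonoidAlgebra k Q} (hx : ∀ h ∈ H, x * MonoidAlgebra.single h 1 = x) :
    x * avg k H = x := by
  have := Fintype.ofFinite H
  rw [avg_eq_sum, mul_smul_comm, Finset.mul_sum, Finset.sum_congr rfl fun (h : H) _ => hx h h.2,
    Finset.sum_const, Finset.card_univ, ← Nat.card_eq_fintype_card, ← Nat.cast_smul_eq_nsmul k,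
    smul_smul, inv_mul_cancel₀ hH, one_smul]

lemma avg_idem (H : Subgroup Q) [Finite H] (hH : (Nat.card H : k) ≠ 0) :
    avg k H * avg k H = avg k H :=
  avg_mul_of_left_invariant H hH fun _ hh => single_mul_avg H hh

lemma avg_bot : avg k (⊥ : Subgroup Q) = 1 := by
  simpa using avg_mul_of_left_invariant (k := k) (⊥ : Subgroup Q) (by simp) (x := 1)
    (by simp [MonoidAlgebra.one_def])

lemma avg_mul_comm (H : Subgroup Q) [H.Normal] [Finite H] (x : MonoidAlgebra k Q) :
    avg k H * x = x * avg k H := by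
  have := Fintype.ofFinite H
  induction x using MonoidAlgebra.induction_linear with
  | zero => simp
  | add x y hx hy => rw [mul_add, add_mul, hx, hy]
  | single q r =>
    rw [avg_eq_sum, mul_smul_comm, Finset.mul_sum, smul_mul_assoc, Finset.sum_mul]
    congr 1
    refine (Fintype.sum_equiv (MulAut.conjNormal q : MulAut H).toEquiv _ _ fun h => ?_).symm
    simp [MonoidAlgebra.single_mul_single]

lemma mapDomain_avg (f : Q →* Q') (H : Subgroup Q) [Finite H] (hH : (Nat.card H : k) ≠ 0)
    (hH' : (Nat.card (H.map f) : k) ≠ 0) :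
    MonoidAlgebra.mapDomain f (avg k H) = avg k (H.map f) := by
  have := Fintype.ofFinite H
  have : Finite (H.map f) := Set.Finite.image f (Set.toFinite (H : Set Q))
  have h₁ : avg k (H.map f) * MonoidAlgebra.mapDomain f (avg k H) =
      MonoidAlgebra.mapDomain f (avg k H) := by
    refine avg_mul_of_left_invariant _ hH' ?_
    rintro _ ⟨h, hh, rfl⟩
    rw [← MonoidAlgebra.mapDomain_single, ← MonoidAlgebra.mapDomain_mul, single_mul_avg H hh]
  have h₂ : avg k (H.map f) * MonoidAlgebra.mapDomain f (avg k H) = avg k (H.map f) := by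
    have key : MonoidAlgebra.mapDomain f (avg k H) =
        (Nat.card H : k)⁻¹ • ∑ h : H, MonoidAlgebra.single (f h) 1 := by
      change MonoidAlgebra.mapDomainAlgHom k k f _ = _
      rw [avg_eq_sum, map_smul, map_sum]
      simp
    rw [key, mul_smul_comm, Finset.mul_sum, Finset.sum_congr rfl fun (h : H) _ =>
      avg_mul_single (H.map f) (Subgroup.mem_map_of_mem f h.2), Finset.sum_const,
      Finset.card_univ, ← Nat.card_eq_fintype_card, ← Nat.cast_smul_eq_nsmul k,
      smul_smul, inv_mul_cancel₀ hH, one_smul]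
  rw [← h₁, h₂]

lemma eq_zero_of_mul_avg_ker (f : Q →* Q') [Finite f.ker] {x : MonoidAlgebra k Q}
    (hx : x * avg k f.ker = x) (h0 : MonoidAlgebra.mapDomain f x = 0) : x = 0 := by
  have key : ∀ y : MonoidAlgebra k Q, y * avg k f.ker =
      MonoidAlgebra.mapDomain (Function.invFun f) (MonoidAlgebra.mapDomain f y) *
        avg k f.ker := by
    intro y
    induction y using MonoidAlgebra.induction_linear with
    | zero => simp
    | add y z hy hz => simp only [MonoidAlgebra.mapDomain_add, add_mul, hy, hz]
    | single q r =>
      have hs : f (Function.invFun f (f q)) = f q := Function.invFun_eq ⟨q, rfl⟩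
      have hk : q⁻¹ * Function.invFun f (f q) ∈ f.ker := by
        rw [MonoidHom.mem_ker, map_mul, hs, ← map_mul, inv_mul_cancel, map_one]
      rw [MonoidAlgebra.mapDomain_single, MonoidAlgebra.mapDomain_single]
      nth_rewrite 1 [← single_mul_avg f.ker hk]
      rw [← mul_assoc, MonoidAlgebra.single_mul_single, mul_inv_cancel_left, mul_one]
  rw [← hx, key, h0, MonoidAlgebra.mapDomain_zero, zero_mul]

lemma mapDomain_eq_zero_of_ker_invariant [Finite Q] (f : Q →* Q')
    (hf : (Nat.card f.ker : k) = 0) {x : MonoidAlgebra k Q}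
    (hx : ∀ h ∈ f.ker, MonoidAlgebra.single h 1 * x = x) :
    MonoidAlgebra.mapDomain f x = 0 := by
  have := Fintype.ofFinite Q
  have hc : ∀ h ∈ f.ker, ∀ q, x.coeff (h * q) = x.coeff q := by
    intro h hh q
    conv_lhs => rw [← hx h hh]
    simp
  ext c
  change (Finsupp.mapDomain f x.coeff) c = 0
  rw [Finsupp.mapDomain, Finsupp.sum_fintype _ _ (by simp), Finsupp.finsetSum_apply]
  simp only [Finsupp.single_apply]
  rw [← Finset.sum_filter]
  by_cases hr : c ∈ Set.range f
  · obtain ⟨q, rfl⟩ := hr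
    rw [Finset.sum_congr rfl (g := fun _ => x.coeff q), Finset.sum_const,
      MonoidHom.card_fiber_eq_of_mem_range f ⟨q, rfl⟩ ⟨1, map_one f⟩,
      ← Nat.cast_smul_eq_nsmul k]
    · convert zero_smul k _
      rw [← hf, Nat.card_eq_fintype_card, Fintype.card_subtype]
      simp only [MonoidHom.mem_ker]
    · intro g hg
      have : g * q⁻¹ ∈ f.ker := by simpa [mul_inv_eq_one] using hg
      simpa using hc _ this q
  · refine Finset.sum_eq_zero fun g hg => absurd ⟨g, ?_⟩ hr
    simpa using hg

end GroupAlgebra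

lemma finsum_out_eq_relIndex_nsmul {G A : Type} [Group G] [AddCommMonoid A] {H K : Subgroup G}
    (hHK : H ≤ K) [H.FiniteIndex] (F : G → A) (hF : ∀ g, ∀ x ∈ K, F (g * x) = F g) :
    ∑ᶠ c : G ⧸ H, F (Quotient.out c) =
      H.relIndex K • ∑ᶠ c : G ⧸ K, F (Quotient.out c) := by
  have : K.FiniteIndex := Subgroup.finiteIndex_of_le hHK
  have := Fintype.ofFinite (G ⧸ H)
  have := Fintype.ofFinite (G ⧸ K)
  have : Finite ((G ⧸ K) × K ⧸ H.subgroupOf K) :=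
    Finite.of_equiv _ (Subgroup.quotientEquivProdOfLE hHK)
  have : Finite (K ⧸ H.subgroupOf K) := Finite.of_surjective
    (Prod.snd : (G ⧸ K) × K ⧸ H.subgroupOf K → _) Prod.snd_surjective
  have := Fintype.ofFinite (K ⧸ H.subgroupOf K)
  have hout : ∀ g : G, F (Quotient.out (g : G ⧸ K)) = F g := by
    intro g
    obtain ⟨x, hx⟩ := QuotientGroup.mk_out_eq_mul K g
    rw [hx, hF _ _ x.2]
  rw [finsum_eq_sum_of_fintype, finsum_eq_sum_of_fintype,
    Fintype.sum_equiv (Subgroup.quotientEquivProdOfLE hHK) _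
      (fun c => F (Quotient.out c.1)), Fintype.sum_prod_type]
  · simp only [Finset.sum_const, Finset.card_univ]
    rw [Finset.smul_sum, Subgroup.relIndex, Subgroup.index, Nat.card_eq_fintype_card]
  · intro c
    have : ((Subgroup.quotientEquivProdOfLE hHK) c).1 = ((Quotient.out c : G) : G ⧸ K) := by
      conv_lhs => rw [← QuotientGroup.out_eq' c]
      rfl
    rw [this, hout]

lemma relIndex_sup_sup_eq {G : Type} [Group G] {D M N : Subgroup G} [M.Normal] [N.Normal]
    [Finite D] (hMN : M ≤ N) (hDN : D ⊓ N = ⊥) :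
    (D ⊔ M).relIndex (D ⊔ N) = M.relIndex N := by
  have hDM : M ⊓ D = ⊥ := by
    rw [inf_comm]
    exact le_bot_iff.1 (hDN ▸ inf_le_inf_left D hMN)
  have h₁ := Subgroup.relIndex_mul_relIndex M (D ⊔ M) (D ⊔ N) le_sup_right
    (sup_le_sup_left hMN D)
  have h₂ := Subgroup.relIndex_mul_relIndex M N (D ⊔ N) hMN le_sup_right
  rw [Subgroup.relIndex_sup_right, ← Subgroup.inf_relIndex_right, hDM,
    Subgroup.relIndex_bot_left] at h₁
  rw [Subgroup.relIndex_sup_right, ← Subgroup.inf_relIndex_right N, inf_comm, hDN,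
    Subgroup.relIndex_bot_left] at h₂
  exact Nat.eq_of_mul_eq_mul_left Nat.card_pos (h₁.trans (h₂.symm.trans (mul_comm _ _)))

lemma card_map_mk' {G : Type} [Group G] (N M : Subgroup G) [N.Normal] :
    Nat.card (M.map (QuotientGroup.mk' N)) = N.relIndex M := by
  conv_rhs => rw [← QuotientGroup.ker_mk' N]
  exact (Subgroup.relIndex_ker _ _).symm

section Projections

variable {k : Type} [Field k] {G : Type} [Group G] [TopologicalSpace G]

variable (k G) in
/-- The projection `k⟦G⟧ → k[G/N]` as an algebra homomorphism. -/
def projHom (N : OpenNormalSubgroup G) :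
    CGA k G →ₐ[k] MonoidAlgebra k (G ⧸ N.toSubgroup) :=
  (Pi.evalAlgHom k (fun N : OpenNormalSubgroup G => MonoidAlgebra k (G ⧸ N.toSubgroup)) N).comp
    (CGA k G).val

lemma projHom_ext {x y : CGA k G} (h : ∀ N, projHom k G N x = projHom k G N y) : x = y :=
  Subtype.ext (funext h)

lemma mapDomain_projHom {N M : OpenNormalSubgroup G} (h : N ≤ M) (x : CGA k G) :
    MonoidAlgebra.mapDomain (qHom G N M h) (projHom k G N x) = projHom k G M x :=
  x.2 N M h

lemma projHom_eq_zero_of_le {N M : OpenNormalSubgroup G} (h : N ≤ M) {x : CGA k G}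
    (hx : projHom k G N x = 0) : projHom k G M x = 0 := by
  rw [← mapDomain_projHom h, hx, MonoidAlgebra.mapDomain_zero]

lemma projHom_ofG (N : OpenNormalSubgroup G) (g : G) :
    projHom k G N (ofG k G g) = MonoidAlgebra.single (g : G ⧸ N.toSubgroup) 1 :=
  rfl

lemma exists_projHom_ne_zero {x : CGA k G} (hx : x ≠ 0) : ∃ N, projHom k G N x ≠ 0 := by
  by_contra! h
  exact hx (projHom_ext fun N => by rw [h N, map_zero])

lemma ker_qHom {N M : OpenNormalSubgroup G} (h : N ≤ M) :
    (qHom G N M h).ker = M.toSubgroup.map (QuotientGroup.mk' N.toSubgroup) := by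
  ext q
  obtain ⟨g, rfl⟩ := QuotientGroup.mk_surjective q
  rw [MonoidHom.mem_ker]
  change ((g : G ⧸ M.toSubgroup) = 1) ↔ _
  rw [QuotientGroup.eq_one_iff]
  refine ⟨fun hg => ⟨g, hg, rfl⟩, ?_⟩
  rintro ⟨m, hm, hmg⟩
  have := h (QuotientGroup.eq.1 hmg)
  simpa using mul_mem hm this

lemma exists_projHom_injOn_of_finiteDimensional (B : Submodule k (CGA k G))
    [FiniteDimensional k B] :
    ∃ N : OpenNormalSubgroup G, ∀ b ∈ B, projHom k G N b = 0 → b = 0 := by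
  let K : OpenNormalSubgroup G → Submodule k B := fun N =>
    LinearMap.ker ((projHom k G N).toLinearMap.comp B.subtype)
  have : Nonempty (OpenNormalSubgroup G) := ⟨⟨⊤, inferInstanceAs (⊤ : Subgroup G).Normal⟩⟩
  obtain ⟨_, ⟨N, rfl⟩, hmin⟩ := WellFounded.has_min
    (IsWellFounded.wf : WellFounded ((· < ·) : Submodule k B → Submodule k B → Prop))
    (Set.range K) (Set.range_nonempty K)
  refine ⟨N, fun b hb hbN => projHom_ext fun M => ?_⟩
  have hle : K (M ⊓ N) ≤ K N := fun x hx =>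
    projHom_eq_zero_of_le (inf_le_right : M ⊓ N ≤ N) hx
  have heq : K (M ⊓ N) = K N := by
    by_contra hne
    exact hmin _ ⟨_, rfl⟩ (lt_of_le_of_ne hle hne)
  have hb' : (⟨b, hb⟩ : B) ∈ K (M ⊓ N) := heq ▸ hbN
  rw [map_zero]
  exact projHom_eq_zero_of_le (inf_le_left : M ⊓ N ≤ M) hb'

variable [IsTopologicalGroup G] [CompactSpace G]

instance (N : OpenNormalSubgroup G) : Finite (G ⧸ N.toSubgroup) :=
  Subgroup.quotient_finite_of_isOpen _ N.isOpen'

instance (N : OpenNormalSubgroup G) : N.toSubgroup.FiniteIndex :=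
  Subgroup.finiteIndex_of_finite_quotient

variable (k) in
lemma relIndex_ne_zero_of_defectProp {e : CGA k G} {D : Subgroup G} [Finite D]
    (hD : DefectProp k G e D) {M N : OpenNormalSubgroup G} (hMN : M ≤ N)
    (hDN : D ⊓ N.toSubgroup = ⊥) (he : projHom k G N e ≠ 0) :
    (M.toSubgroup.relIndex N.toSubgroup : k) ≠ 0 := by
  intro h0
  obtain ⟨x, hx, rfl⟩ := hD M
  have : (D ⊔ M.toSubgroup).FiniteIndex :=
    Subgroup.finiteIndex_of_le (H := M.toSubgroup) le_sup_right
  have hMN' : M.toSubgroup ≤ N.toSubgroup := hMN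
  apply he
  rw [trMap]
  refine (AddMonoidHom.map_finsum (projHom k G N).toRingHom.toAddMonoidHom
    (Set.toFinite _)).trans ?_
  have hF : ∀ g, ∀ y ∈ D ⊔ N.toSubgroup,
      projHom k G N (conjAct k G (g * y) x) = projHom k G N (conjAct k G g x) := by
    intro g y hy
    have hcomp : ∀ a b, conjAct k G (a * b) x = conjAct k G a (conjAct k G b x) := by
      intro a b
      simp only [conjAct, mul_inv_rev, map_mul, mul_assoc]
    obtain ⟨d, hd, n, hn, rfl⟩ := Subgroup.mem_sup_of_normal_right.1 hy
    have hdx : conjAct k G d x = x := hx d (Subgroup.mem_sup_left hd)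
    have hn1 : ∀ m ∈ N.toSubgroup, projHom k G N (ofG k G m) = 1 := by
      intro m hm
      rw [projHom_ofG, (QuotientGroup.eq_one_iff m).2 hm, MonoidAlgebra.one_def]
    have hnx : projHom k G N (conjAct k G n x) = projHom k G N x := by
      rw [conjAct, map_mul, map_mul, hn1 n hn, hn1 _ (inv_mem hn), one_mul, mul_one]
    rw [← mul_assoc, hcomp, conjAct, map_mul, map_mul, hnx, ← map_mul, ← map_mul]
    change projHom k G N (conjAct k G (g * d) x) = _
    rw [hcomp, hdx]
  refine (finsum_out_eq_relIndex_nsmul (sup_le_sup_left hMN' D)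
    (fun g => projHom k G N (conjAct k G g x)) hF).trans ?_
  rw [relIndex_sup_sup_eq hMN' hDN, ← Nat.cast_smul_eq_nsmul k, h0, zero_smul]

/-- The central idempotent of `k⟦G⟧` given by averaging over an open normal subgroup `N` all of
whose finite quotients `N/M` have order invertible in `k`. -/
def avgCGA (N : OpenNormalSubgroup G)
    (hN : ∀ M : OpenNormalSubgroup G, (M.toSubgroup.relIndex N.toSubgroup : k) ≠ 0) : CGA k G :=
  ⟨fun M => avg k (N.toSubgroup.map (QuotientGroup.mk' M.toSubgroup)), by
    intro M M' h
    have hmap : (N.toSubgroup.map (QuotientGroup.mk' M.toSubgroup)).map (qHom G M M' h) =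
        N.toSubgroup.map (QuotientGroup.mk' M'.toSubgroup) := by
      rw [Subgroup.map_map]
      rfl
    change MonoidAlgebra.mapDomain (qHom G M M' h) _ = _
    rw [mapDomain_avg, hmap]
    · rw [card_map_mk']
      exact hN M
    · rw [hmap, card_map_mk']
      exact hN M'⟩

lemma finiteDimensional_blockMod_of_relIndex_ne_zero {e : CGA k G} (he : IsBlockIdem (CGA k G) e)
    (N : OpenNormalSubgroup G) (heN : projHom k G N e ≠ 0)
    (hN : ∀ M : OpenNormalSubgroup G, (M.toSubgroup.relIndex N.toSubgroup : k) ≠ 0) :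
    FiniteDimensional k (blockMod (CGA k G) e he.central) := by
  set s : CGA k G := avgCGA N hN
  have hs : ∀ M, projHom k G M s = avg k (N.toSubgroup.map (QuotientGroup.mk' M.toSubgroup)) :=
    fun _ => rfl
  have hnorm : ∀ M : OpenNormalSubgroup G,
      (N.toSubgroup.map (QuotientGroup.mk' M.toSubgroup)).Normal := fun M =>
    Subgroup.Normal.map inferInstance _ (QuotientGroup.mk'_surjective _)
  have hcomm : ∀ x, s * x = x * s := fun x => projHom_ext fun M => by
    have := hnorm M
    rw [map_mul, map_mul, hs, avg_mul_comm]
  have hidem : s * s = s := projHom_ext fun M => by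
    rw [map_mul, hs, avg_idem]
    rw [card_map_mk']
    exact hN M
  have hecomm : ∀ x, e * x = x * e := fun x => (Set.mem_center_iff.1 he.central).comm x
  have hee : e * e = e := he.idem
  have hsc : s ∈ Set.center (CGA k G) := Semigroup.mem_center_iff.2 fun x => (hcomm x).symm
  have hsc' : 1 - s ∈ Set.center (CGA k G) :=
    Semigroup.mem_center_iff.2 fun x => by rw [mul_sub, sub_mul, mul_one, one_mul, hcomm]
  have hmul : ∀ t, t * t = t → (e * t) * (e * t) = e * t := fun t ht => by
    rw [mul_assoc, ← mul_assoc t, ← hecomm t, mul_assoc e t t, ht, ← mul_assoc, hee]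
  have horth : s * (1 - s) = 0 := by rw [mul_sub, mul_one, hidem, sub_self]
  have horth' : (1 - s) * s = 0 := by rw [sub_mul, one_mul, hidem, sub_self]
  have hids : (1 - s) * (1 - s) = 1 - s := by rw [sub_mul, one_mul, horth, sub_zero]
  have hprod : ∀ t u, t * u = 0 → (e * t) * (e * u) = 0 := fun t u htu => by
    rw [hecomm t, mul_assoc, ← mul_assoc e, hee, hecomm u, ← mul_assoc, htu, zero_mul]
  have hes : e = e * s := by
    rcases he.primitive (e * s) (e * (1 - s)) (Set.mul_mem_center he.central hsc)
      (Set.mul_mem_center he.central hsc') (hmul _ hidem) (hmul _ hids)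
      (hprod _ _ horth) (hprod _ _ horth') (by rw [← mul_add]; simp) with h | h
    · refine absurd ?_ heN
      have h1 : projHom k G N s = 1 := by
        have hbot : N.toSubgroup.map (QuotientGroup.mk' N.toSubgroup) = ⊥ := by
          rw [Subgroup.map_eq_bot_iff, QuotientGroup.ker_mk']
        rw [hs, hbot, avg_bot]
      have := congrArg (projHom k G N) h
      rwa [map_mul, h1, mul_one, map_zero] at this
    · rwa [mul_sub, mul_one, sub_eq_zero] at h
  let f : blockMod (CGA k G) e he.central →ₗ[k] MonoidAlgebra k (G ⧸ N.toSubgroup) :=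
    (projHom k G N).toLinearMap.comp ((blockMod (CGA k G) e he.central).subtype.restrictScalars k)
  have : FiniteDimensional k (MonoidAlgebra k (G ⧸ N.toSubgroup)) := inferInstance
  refine FiniteDimensional.of_injective f ?_
  rw [injective_iff_map_eq_zero]
  rintro ⟨a, ha⟩ hfa
  have ha0 : projHom k G N a = 0 := hfa
  have hae : a * e = a := ha
  have has : a * s = a := by rw [← hae, mul_assoc, ← hes]
  refine Subtype.ext (projHom_ext fun M => ?_)
  rw [ZeroMemClass.coe_zero, map_zero]
  refine projHom_eq_zero_of_le (inf_le_left : M ⊓ N ≤ M) ?_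
  refine eq_zero_of_mul_avg_ker (qHom G (M ⊓ N) N inf_le_right) ?_ ?_
  · rw [ker_qHom, ← hs, ← map_mul, has]
  · rw [mapDomain_projHom, ha0]

variable [TotallyDisconnectedSpace G]

lemma exists_openNormalSubgroup_disjoint [T2Space G] {e : CGA k G} (he : e ≠ 0) (D : Subgroup G)
    [Finite D] : ∃ N : OpenNormalSubgroup G, D ⊓ N.toSubgroup = ⊥ ∧ projHom k G N e ≠ 0 := by
  have hfin : ((D : Set G) \ {1}).Finite := (Set.toFinite (D : Set G)).subset Set.sdiff_subset
  obtain ⟨N, hN⟩ := ProfiniteGrp.exist_openNormalSubgroup_sub_open_nhds_of_one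
    hfin.isClosed.isOpen_compl (by simp)
  obtain ⟨N', hN'⟩ := exists_projHom_ne_zero he
  refine ⟨N ⊓ N', ?_, fun h => hN' (projHom_eq_zero_of_le inf_le_right h)⟩
  rw [eq_bot_iff]
  rintro x ⟨hxD, hxN⟩
  have hx : x ∈ N := hxN.1
  by_contra hx1
  exact hN hx ⟨hxD, hx1⟩

lemma exists_dvd_relIndex_of_isZpGroup [T2Space G] {p : ℕ} [Fact p.Prime] {D : Subgroup G}
    (hD : IsZpGroup G p D) (N : OpenNormalSubgroup G) :
    ∃ M : OpenNormalSubgroup G, M ≤ N ∧ p ∣ M.toSubgroup.relIndex N.toSubgroup := by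
  obtain ⟨φ, hφ⟩ := hD
  let ψ : D ≃* Multiplicative ℤ_[p] := { φ.toEquiv with map_mul' := hφ }
  let d : D := ψ.symm (Multiplicative.ofAdd 1)
  let x : D := d ^ N.toSubgroup.index
  have hxN : (x : G) ∈ N.toSubgroup := by
    have := Subgroup.pow_index_mem N.toSubgroup (d : G)
    simpa [x] using this
  have hψx : ψ x = Multiplicative.ofAdd (N.toSubgroup.index : ℤ_[p]) := by
    simp only [x, d, map_pow, MulEquiv.apply_symm_apply, ← ofAdd_nsmul]
    simp
  have hx1 : (x : G) ≠ 1 := by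
    intro h
    have h1 : x = 1 := Subtype.ext h
    rw [h1, map_one] at hψx
    have : (N.toSubgroup.index : ℤ_[p]) = 0 := (Multiplicative.ofAdd.injective hψx).symm
    exact Subgroup.FiniteIndex.index_ne_zero (H := N.toSubgroup) (by exact_mod_cast this)
  obtain ⟨M, hM⟩ := ProfiniteGrp.exist_openNormalSubgroup_sub_open_nhds_of_one
    (isClosed_singleton (x := (x : G))).isOpen_compl (by simpa using hx1.symm)
  refine ⟨M ⊓ N, inf_le_right, ?_⟩
  have hxM : (x : G) ∉ (M ⊓ N).toSubgroup := fun h => hM h.1 rfl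
  have hlim : Filter.Tendsto (fun n => ((x ^ p ^ n : D) : G)) Filter.atTop (nhds 1) := by
    have hp : Filter.Tendsto (fun n => (p : ℤ_[p]) ^ n * (N.toSubgroup.index : ℤ_[p]))
        Filter.atTop (nhds 0) := by
      have := tendsto_pow_atTop_nhds_zero_of_norm_lt_one (x := (p : ℤ_[p]))
        (by
          rw [PadicInt.norm_p]
          exact inv_lt_one_of_one_lt₀ (by exact_mod_cast (Fact.out : p.Prime).one_lt))
      simpa using this.mul_const (N.toSubgroup.index : ℤ_[p])
    have hc : Continuous fun z : ℤ_[p] => ((φ.symm (Multiplicative.ofAdd z) : D) : G) :=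
      continuous_subtype_val.comp (φ.symm.continuous.comp continuous_ofAdd)
    have h0 : ((φ.symm (Multiplicative.ofAdd 0) : D) : G) = 1 := by
      have : ψ.symm 1 = 1 := map_one _
      exact congrArg Subtype.val this
    have := (hc.tendsto 0).comp hp
    rw [h0] at this
    refine this.congr fun n => ?_
    have : ψ.symm (Multiplicative.ofAdd ((p : ℤ_[p]) ^ n * (N.toSubgroup.index : ℤ_[p]))) =
        x ^ p ^ n := by
      rw [MulEquiv.symm_apply_eq, map_pow, hψx, ← ofAdd_nsmul]
      simp
    exact congrArg Subtype.val this
  obtain ⟨n, hn⟩ :=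
    (hlim.eventually ((M ⊓ N).isOpen'.mem_nhds (one_mem (M ⊓ N).toSubgroup))).exists
  rw [← card_map_mk']
  let q : N.toSubgroup.map (QuotientGroup.mk' (M ⊓ N).toSubgroup) :=
    ⟨_, Subgroup.mem_map_of_mem _ hxN⟩
  have hq1 : q ≠ 1 := fun h => hxM ((QuotientGroup.eq_one_iff _).1 (congrArg Subtype.val h))
  have hqp : q ^ p ^ n = 1 := by
    exact Subtype.ext ((QuotientGroup.eq_one_iff ((x : G) ^ p ^ n)).2 hn)
  obtain ⟨j, -, hj⟩ := (Nat.dvd_prime_pow Fact.out).1 (orderOf_dvd_of_pow_eq_one hqp)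
  have hj0 : j ≠ 0 := by
    rintro rfl
    exact hq1 (orderOf_eq_one_iff.1 (by simpa using hj))
  exact (dvd_pow_self p hj0).trans (hj ▸ orderOf_dvd_natCard q)

end Projections

/-- Theorem 4.3: a block of a profinite group with cyclic defect
group `D` is finite-dimensional over `k` if and only if `D` is finite. -/
theorem defect_finite_iff_block_finite_dimensional
    (p : ℕ) [Fact p.Prime] (k : Type) [Field k] [CharP k p] [IsAlgClosed k]
    (G : Type) [Group G] [TopologicalSpace G] [IsTopologicalGroup G]
    [CompactSpace G] [TotallyDisconnectedSpace G] [T2Space G]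
    (e : CGA k G) (he : IsBlockIdem (CGA k G) e)
    (D : Subgroup G) (hD : IsDefectGroup k G e D)
    (hcyc : IsCyclicProP G p D) :
    Finite D ↔ FiniteDimensional k (blockMod (CGA k G) e he.central) := by
  constructor
  · intro _
    obtain ⟨N, hDN, heN⟩ := exists_openNormalSubgroup_disjoint he.ne_zero D
    refine finiteDimensional_blockMod_of_relIndex_ne_zero he N heN fun M => ?_
    have := relIndex_ne_zero_of_defectProp k hD.defect (inf_le_right : M ⊓ N ≤ N) hDN heN
    rwa [← Subgroup.inf_relIndex_right]
  · intro hfd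
    rcases hcyc with h | hZp
    · exact h.1
    have : FiniteDimensional k ((blockMod (CGA k G) e he.central).restrictScalars k) := hfd
    obtain ⟨N, hN⟩ := exists_projHom_injOn_of_finiteDimensional
      ((blockMod (CGA k G) e he.central).restrictScalars k)
    have hee : e * e = e := he.idem
    have hinv : ∀ n ∈ N.toSubgroup, ofG k G n * e = e := by
      intro n hn
      rw [← sub_eq_zero]
      refine hN _ ?_ ?_
      · change (ofG k G n * e - e) * e = ofG k G n * e - e
        rw [sub_mul, mul_assoc, hee]
      · rw [map_sub, map_mul, projHom_ofG, (QuotientGroup.eq_one_iff n).2 hn,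
          ← MonoidAlgebra.one_def, one_mul, sub_self]
    obtain ⟨M, hMN, hdvd⟩ := exists_dvd_relIndex_of_isZpGroup hZp N
    refine absurd (hN e hee ?_) he.ne_zero
    rw [← mapDomain_projHom hMN]
    refine mapDomain_eq_zero_of_ker_invariant _ ?_ ?_
    · rw [ker_qHom, card_map_mk']
      exact (CharP.cast_eq_zero_iff k p _).2 hdvd
    · rw [ker_qHom]
      rintro _ ⟨n, hn, rfl⟩
      change projHom k G M (ofG k G n) * _ = _
      rw [← map_mul, hinv n hn]

end ProfiniteBlocks
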